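/- (Combinatorial core of Theorem 1.) For every integer n ≥ 9 there is no n-dimensional simple polytope P in ℝⁿ such that P has no triangular 2-faces and every vertex of P is contained in at most n+6 quadrilateral 2-faces. -/

import Mathlib

open scoped BigOperators

noncomputable section

/-- `E n` is Euclidean `n`-space. -/
abbrev E (n : ℕ) := EuclideanSpace ℝ (Fin n)

/-- A polytope is the convex hull of a nonempty finite set of points. -/
def IsPolytope {n : ℕ} (P : Set (E n)) : Prop :=
  ∃ S : Finset (E n), S.Nonempty ∧ P = convexHull ℝ (S : Set (E n))

/-- A face of `P` is a nonempty proper exposed face of `P`. -/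
def IsFace {n : ℕ} (P F : Set (E n)) : Prop :=
  F.Nonempty ∧ F ≠ P ∧ IsExposed ℝ P F

/-- The dimension of a face: the rank of the direction of its affine span. -/
def faceDim {n : ℕ} (F : Set (E n)) : ℕ :=
  Module.finrank ℝ (affineSpan ℝ F).direction

/-- An `i`-face of `P` is a face of dimension `i`. -/
def IsIFace {n : ℕ} (P F : Set (E n)) (i : ℕ) : Prop :=
  IsFace P F ∧ faceDim F = i

/-- The set of `i`-faces of `P`. -/
def facesOf {n : ℕ} (P : Set (E n)) (i : ℕ) : Set (Set (E n)) :=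
  {F | IsIFace P F i}

/-- `P` is an `n`-dimensional simple polytope: it is a polytope affinely spanning `ℝⁿ`
and every `k`-face (`0 ≤ k ≤ n-1`) is contained in exactly `n - k` facets. -/
def IsSimplePolytope (n : ℕ) (P : Set (E n)) : Prop :=
  IsPolytope P ∧ affineSpan ℝ P = ⊤ ∧
    ∀ k : ℕ, k ≤ n - 1 → ∀ F : Set (E n), IsIFace P F k →
      {G : Set (E n) | IsIFace P G (n - 1) ∧ G ⊇ F}.ncard = n - k

/-- `α i`: the number of `i`-faces of `P`. -/
def nFaces {n : ℕ} (P : Set (E n)) (i : ℕ) : ℕ :=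
  (facesOf P i).ncard

/-- `αᵢ^f`: the number of `i`-faces of `P` contained in the face `f`. -/
def nFacesIn {n : ℕ} (P f : Set (E n)) (i : ℕ) : ℕ :=
  {G : Set (E n) | IsIFace P G i ∧ G ⊆ f}.ncard

/-- `α_k^{(i)}`: the average number of `i`-faces of a `k`-face of `P`. -/
def avgFaces {n : ℕ} (P : Set (E n)) (k i : ℕ) : ℝ :=
  (1 / (nFaces P k : ℝ)) * ∑ᶠ f ∈ facesOf P k, (nFacesIn P f i : ℝ)

/-- `m i`: the number of 2-faces of `P` containing exactly `i` vertices of `P`. -/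
def m2Faces {n : ℕ} (P : Set (E n)) (i : ℕ) : ℕ :=
  {F : Set (E n) | IsIFace P F 2 ∧ nFacesIn P F 0 = i}.ncard

end

open Classical in
lemma exists_vertex_set {n : ℕ} {P : Set (E n)} (hP : IsPolytope P) :
    ∃ S : Finset (E n), S.Nonempty ∧ P = convexHull ℝ (S : Set (E n)) ∧
      ∀ s ∈ S, IsExposed ℝ P {s} := by
  obtain ⟨S0, hS0, rfl⟩ := hP
  have hcomp : IsCompact (convexHull ℝ (S0 : Set (E n))) := S0.finite_toSet.isCompact_convexHull ℝ
  have hsub : (convexHull ℝ (S0 : Set (E n))).extremePoints ℝ ⊆ S0 :=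
    extremePoints_convexHull_subset
  have hfin : ((convexHull ℝ (S0 : Set (E n))).extremePoints ℝ).Finite :=
    S0.finite_toSet.subset hsub
  have hKM := closure_convexHull_extremePoints hcomp (convex_convexHull ℝ _)
  rw [(hfin.isClosed_convexHull ℝ).closure_eq] at hKM
  refine ⟨hfin.toFinset, ?_, ?_, ?_⟩
  · rw [Set.Finite.toFinset_nonempty]
    exact hcomp.extremePoints_nonempty (by simpa using hS0)
  · rw [hfin.coe_toFinset, hKM]
  · intro s hs
    rw [hfin.mem_toFinset] at hs
    set X := (convexHull ℝ (S0 : Set (E n))).extremePoints ℝ with hX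
    have hnot : s ∉ convexHull ℝ (X \ {s}) := by
      have h1 := ((convex_convexHull ℝ _).mem_extremePoints_iff_convex_sdiff.1 hs).2
      intro h
      have h2 : X \ {s} ⊆ convexHull ℝ (S0 : Set (E n)) \ {s} :=
        Set.sdiff_subset_sdiff_left extremePoints_subset
      exact (convexHull_min h2 h1 h).2 rfl
    obtain ⟨f, u, hu, hs'⟩ := geometric_hahn_banach_closed_point (convex_convexHull ℝ (X \ {s}))
      ((hfin.subset Set.sdiff_subset).isClosed_convexHull ℝ) hnot
    have hlt : ∀ t ∈ X, t ≠ s → f t < f s := fun t ht hts =>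
      (hu t (subset_convexHull ℝ _ ⟨ht, hts⟩)).trans hs'
    rw [← mem_exposedPoints_iff_exposed_singleton]
    refine ⟨extremePoints_subset hs, f, ?_⟩
    intro y hy
    rw [← hKM] at hy
    have hy' : y ∈ convexHull ℝ ((hfin.toFinset : Finset (E n)) : Set (E n)) := by
      rwa [hfin.coe_toFinset]
    rw [Finset.mem_convexHull'] at hy'
    obtain ⟨w, hw0, hw1, rfl⟩ := hy'
    have key : ∑ t ∈ hfin.toFinset, w t * (f s - f t) = f s - f (∑ t ∈ hfin.toFinset, w t • t) := by
      simp only [map_sum, map_smul, smul_eq_mul, mul_sub, Finset.sum_sub_distrib, ← Finset.sum_mul, hw1, one_mul]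
    have hterm : ∀ t ∈ hfin.toFinset, 0 ≤ w t * (f s - f t) := by
      intro t ht
      rcases eq_or_ne t s with rfl | hne
      · simp
      · exact mul_nonneg (hw0 t ht) (sub_nonneg.2 (hlt t (by simpa using ht) hne).le)
    refine ⟨by linarith [Finset.sum_nonneg hterm], fun hle => ?_⟩
    have hz : ∑ t ∈ hfin.toFinset, w t * (f s - f t) = 0 :=
      le_antisymm (by linarith) (Finset.sum_nonneg hterm)
    rw [Finset.sum_eq_zero_iff_of_nonneg hterm] at hz
    have hw : ∀ t ∈ hfin.toFinset, t ≠ s → w t = 0 := by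
      intro t ht hne
      rcases mul_eq_zero.1 (hz t ht) with h | h
      · exact h
      · linarith [hlt t (by simpa using ht) hne]
    have hs2 : s ∈ hfin.toFinset := by simpa using hs
    have e1 : ∑ t ∈ hfin.toFinset, w t = w s :=
      Finset.sum_eq_single_of_mem s hs2 (fun t ht hne => hw t ht hne)
    have e2 : ∑ t ∈ hfin.toFinset, w t • t = w s • s :=
      Finset.sum_eq_single_of_mem s hs2 (fun t ht hne => by rw [hw t ht hne, zero_smul])
    rw [e2, ← e1, hw1, one_smul]

lemma hull_nonneg {n : ℕ} {S : Finset (E n)} (f : E n →ₗ[ℝ] ℝ) (a : ℝ)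
    (h : ∀ s ∈ S, a ≤ f s) : ∀ x ∈ convexHull ℝ (S : Set (E n)), a ≤ f x :=
  fun _ hx => convexHull_min (t := {x | a ≤ f x}) h (convex_halfSpace_ge f.isLinear a) hx

/-- face at `v` cut out by a functional nonneg on `P - v` -/
lemma exposed_of_nonneg {n : ℕ} {S : Finset (E n)} {v : E n} (hv : v ∈ S) (f : E n →ₗ[ℝ] ℝ)
    (h : ∀ s ∈ S, 0 ≤ f (s - v)) :
    IsExposed ℝ (convexHull ℝ (S : Set (E n)))
      {x | x ∈ convexHull ℝ (S : Set (E n)) ∧ f (x - v) = 0} := by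
  intro _
  refine ⟨-(LinearMap.toContinuousLinearMap f), ?_⟩
  have h' : ∀ x ∈ convexHull ℝ (S : Set (E n)), f v ≤ f x :=
    hull_nonneg f _ (fun s hs => by have := h s hs; rw [map_sub] at this; linarith)
  ext x
  simp only [Set.mem_ofPred_eq, map_sub]
  refine and_congr_right fun hx => ⟨fun hxe y hy => ?_, fun hy => ?_⟩
  · simp only [neg_apply, LinearMap.coe_toContinuousLinearMap']
    linarith [h' y hy]
  · have := hy v (subset_convexHull ℝ _ hv)
    simp only [neg_apply, LinearMap.coe_toContinuousLinearMap'] at this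
    linarith [h' x hx]

lemma perturb {n : ℕ} {S : Finset (E n)} {v y z : E n}
    (hy : ∀ s ∈ S, 0 ≤ inner ℝ y (s - v))
    (hz : ∀ s ∈ S, inner ℝ y (s - v) = 0 → 0 ≤ inner ℝ z (s - v)) :
    ∃ ε : ℝ, 0 < ε ∧ ∀ δ : ℝ, 0 ≤ δ → δ ≤ ε → ∀ s ∈ S, 0 ≤ inner ℝ (y + δ • z) (s - v) := by
  induction S using Finset.cons_induction with
  | empty => exact ⟨1, one_pos, by simp⟩
  | cons a S ha ih =>
    obtain ⟨ε, hε, h⟩ := ih (fun s hs => hy s (by simp [hs])) (fun s hs => hz s (by simp [hs]))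
    have hya := hy a (by simp)
    have hza := hz a (by simp)
    obtain ⟨ε', hε', h'⟩ : ∃ ε : ℝ, 0 < ε ∧ ∀ δ : ℝ, 0 ≤ δ → δ ≤ ε →
        0 ≤ inner ℝ (y + δ • z) (a - v) := by
      simp only [inner_add_left, real_inner_smul_left]
      rcases hya.eq_or_lt with h0 | h0
      · exact ⟨1, one_pos, fun δ hδ _ => by have := mul_nonneg hδ (hza h0.symm); linarith⟩
      · set p := inner ℝ y (a - v)
        set q := inner ℝ z (a - v)
        refine ⟨p / (|q| + 1), by positivity, fun δ hδ hle => ?_⟩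
        rw [le_div_iff₀ (by positivity)] at hle
        nlinarith [neg_abs_le q, mul_le_mul_of_nonneg_left (neg_abs_le q) hδ]
    refine ⟨min ε ε', lt_min hε hε', fun δ h0 hle s hs => ?_⟩
    rw [Finset.mem_cons] at hs
    rcases hs with rfl | hs
    · exact h' δ h0 (hle.trans (min_le_right _ _))
    · exact h δ h0 (hle.trans (min_le_left _ _)) s hs

lemma inner_eq_zero_of_span {n : ℕ} {S : Finset (E n)} {v y : E n} (hv : v ∈ S)
    (hspan : affineSpan ℝ (convexHull ℝ (S : Set (E n))) = ⊤)
    (h : ∀ s ∈ S, inner ℝ y (s - v) = 0) : y = 0 := by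
  rw [affineSpan_convexHull] at hspan
  have h1 : vectorSpan ℝ (S : Set (E n)) = ⊤ := by
    rw [← direction_affineSpan, hspan, AffineSubspace.direction_top]
  rw [vectorSpan_eq_span_vsub_set_right ℝ (Finset.mem_coe.2 hv)] at h1
  have h2 : y ∈ (Submodule.span ℝ ((fun x => x -ᵥ v) '' (S : Set (E n))))ᗮ := by
    rw [Submodule.mem_orthogonal']
    intro u hu
    induction hu using Submodule.span_induction with
    | mem x hx => obtain ⟨s, hs, rfl⟩ := hx; exact h s hs
    | zero => simp
    | add x y _ _ hx hy => rw [inner_add_right, hx, hy, add_zero]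
    | smul a x _ hx => rw [inner_smul_right, hx, mul_zero]
  rw [h1, Submodule.top_orthogonal_eq_bot] at h2
  simpa using h2

/-- base of the dual cone -/
def dualBase {n : ℕ} (S : Finset (E n)) (v : E n) : Set (E n) :=
  {y | (∀ s ∈ S, 0 ≤ inner ℝ y (s - v)) ∧ ∑ s ∈ S, inner ℝ y (s - v) = 1}

lemma dualBase_compact {n : ℕ} {S : Finset (E n)} {v : E n} (hv : v ∈ S)
    (hspan : affineSpan ℝ (convexHull ℝ (S : Set (E n))) = ⊤) : IsCompact (dualBase S v) := by
  let Φ : E n →ₗ[ℝ] (S → ℝ) :=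
    LinearMap.pi (fun s => (innerₗ (E n) ((s : E n) - v)))
  have hΦ : ∀ y s, Φ y s = inner ℝ y ((s : E n) - v) := fun y s => by
    change inner ℝ ((s : E n) - v) y = _
    exact real_inner_comm _ _
  have hker : LinearMap.ker Φ = ⊥ := by
    rw [LinearMap.ker_eq_bot']
    intro y hy
    apply inner_eq_zero_of_span hv hspan
    intro s hs
    rw [← hΦ y ⟨s, hs⟩, hy]; rfl
  have hce := LinearMap.isClosedEmbedding_of_injective hker
  have := hce.isCompact_preimage (isCompact_stdSimplex ℝ S)
  convert this using 1
  ext y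
  simp only [dualBase, Set.mem_preimage, stdSimplex, Set.mem_ofPred_eq, hΦ]
  rw [← Finset.sum_coe_sort S]
  simp

lemma dualBase_convex {n : ℕ} (S : Finset (E n)) (v : E n) : Convex ℝ (dualBase S v) := by
  intro x hx y hy a b ha hb hab
  refine ⟨fun s hs => ?_, ?_⟩
  · simp only [inner_add_left, real_inner_smul_left]
    exact add_nonneg (mul_nonneg ha (hx.1 s hs)) (mul_nonneg hb (hy.1 s hs))
  · simp only [inner_add_left, real_inner_smul_left, Finset.sum_add_distrib, ← Finset.mul_sum,
      hx.2, hy.2]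
    simpa using hab

/-- the face of an element of the dual cone -/
def faceOf {n : ℕ} (S : Finset (E n)) (v y : E n) : Set (E n) :=
  {x | x ∈ convexHull ℝ (S : Set (E n)) ∧ innerₗ (E n) y (x - v) = 0}

lemma orth_face {n : ℕ} {S : Finset (E n)} {v y z : E n} (hv : v ∈ S)
    (hy : y ∈ (dualBase S v).extremePoints ℝ)
    (hz : z ∈ (affineSpan ℝ (faceOf S v y)).directionᗮ) :
    z = (∑ s ∈ S, inner ℝ z (s - v)) • y := by
  have hyK : y ∈ dualBase S v := extremePoints_subset hy
  have hvF : v ∈ faceOf S v y := ⟨subset_convexHull ℝ _ hv, by simp⟩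
  set c := ∑ s ∈ S, inner ℝ z (s - v) with hc
  set z' := z - c • y with hz'
  have hsum : ∑ s ∈ S, inner ℝ z' (s - v) = 0 := by
    simp only [hz', inner_sub_left, real_inner_smul_left, Finset.sum_sub_distrib, ← Finset.mul_sum,
      hyK.2]
    rw [← hc]; ring
  have htight : ∀ s ∈ S, inner ℝ y (s - v) = 0 → inner ℝ z' (s - v) = 0 := by
    intro s hs h0
    have hsF : s ∈ faceOf S v y := ⟨subset_convexHull ℝ _ hs, by simpa using h0⟩
    have : s -ᵥ v ∈ (affineSpan ℝ (faceOf S v y)).direction :=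
      AffineSubspace.vsub_mem_direction (subset_affineSpan ℝ _ hsF) (subset_affineSpan ℝ _ hvF)
    have h1 := (Submodule.mem_orthogonal' _ _).1 hz _ this
    rw [vsub_eq_sub] at h1
    rw [hz', inner_sub_left, real_inner_smul_left, h0, h1]; ring
  obtain ⟨ε1, he1, h1⟩ := perturb (z := z') hyK.1 (fun s hs h => (htight s hs h).ge)
  obtain ⟨ε2, he2, h2⟩ := perturb (z := -z') hyK.1
    (fun s hs h => by rw [inner_neg_left, htight s hs h, neg_zero])
  set ε := min ε1 ε2
  have hε : 0 < ε := lt_min he1 he2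
  have hp : y + ε • z' ∈ dualBase S v := by
    refine ⟨h1 ε hε.le (min_le_left _ _), ?_⟩
    simp only [inner_add_left, real_inner_smul_left, Finset.sum_add_distrib, ← Finset.mul_sum,
      hyK.2, hsum]; ring
  have hm : y + ε • (-z') ∈ dualBase S v := by
    refine ⟨h2 ε hε.le (min_le_right _ _), ?_⟩
    simp only [inner_add_left, real_inner_smul_left, inner_neg_left, Finset.sum_add_distrib,
      Finset.sum_neg_distrib, ← Finset.mul_sum, hyK.2, hsum]; ring
  have hseg : y ∈ openSegment ℝ (y + ε • z') (y + ε • (-z')) :=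
    ⟨1/2, 1/2, by norm_num, by norm_num, by norm_num, by module⟩
  have heq := ((mem_extremePoints).1 hy).2 _ hp _ hm hseg
  have hz0 : ε • z' = 0 := by simpa using heq.1
  have : z' = 0 := (smul_eq_zero.1 hz0).resolve_left hε.ne'
  exact sub_eq_zero.1 this

lemma faceOf_facet {n : ℕ} (hn : 1 ≤ n) {S : Finset (E n)} {v y : E n} (hv : v ∈ S)
    (hspan : affineSpan ℝ (convexHull ℝ (S : Set (E n))) = ⊤)
    (hy : y ∈ (dualBase S v).extremePoints ℝ) :
    IsIFace (convexHull ℝ (S : Set (E n))) (faceOf S v y) (n - 1) ∧ v ∈ faceOf S v y := by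
  have hyK : y ∈ dualBase S v := extremePoints_subset hy
  have hvF : v ∈ faceOf S v y := ⟨subset_convexHull ℝ _ hv, by simp⟩
  have hy0 : y ≠ 0 := by
    rintro rfl
    have := hyK.2
    simp at this
  have horth : (affineSpan ℝ (faceOf S v y)).directionᗮ = Submodule.span ℝ {y} := by
    apply le_antisymm
    · intro z hz
      rw [orth_face hv hy hz]
      exact Submodule.smul_mem _ _ (Submodule.mem_span_singleton_self y)
    · rw [Submodule.span_singleton_le_iff_mem, Submodule.mem_orthogonal', direction_affineSpan,
        vectorSpan_eq_span_vsub_set_right ℝ hvF]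
      intro u hu
      induction hu using Submodule.span_induction with
      | mem x hx => obtain ⟨s, hs, rfl⟩ := hx; exact hs.2
      | zero => simp
      | add x y _ _ hx hy => rw [inner_add_right, hx, hy, add_zero]
      | smul a x _ hx => rw [inner_smul_right, hx, mul_zero]
  have hfr := (affineSpan ℝ (faceOf S v y)).direction.finrank_add_finrank_orthogonal
  rw [horth, finrank_span_singleton hy0, finrank_euclideanSpace_fin] at hfr
  have hdim : faceDim (faceOf S v y) = n - 1 := by unfold faceDim; omega
  refine ⟨⟨⟨⟨v, hvF⟩, ?_, ?_⟩, hdim⟩, hvF⟩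
  · intro h
    rw [h] at hdim
    unfold faceDim at hdim
    rw [hspan, AffineSubspace.direction_top, finrank_top, finrank_euclideanSpace_fin] at hdim
    omega
  · exact exposed_of_nonneg hv (innerₗ (E n) y) (fun s hs => by simpa using hyK.1 s hs)

lemma faceOf_inj {n : ℕ} {S : Finset (E n)} {v : E n} (hv : v ∈ S) :
    Set.InjOn (faceOf S v) ((dualBase S v).extremePoints ℝ) := by
  intro y hy y' hy' heq
  have hyK' : y' ∈ dualBase S v := extremePoints_subset hy'
  have hvF : v ∈ faceOf S v y' := ⟨subset_convexHull ℝ _ hv, by simp⟩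
  have : y' ∈ (affineSpan ℝ (faceOf S v y')).directionᗮ := by
    rw [Submodule.mem_orthogonal', direction_affineSpan,
        vectorSpan_eq_span_vsub_set_right ℝ hvF]
    intro u hu
    induction hu using Submodule.span_induction with
    | mem x hx => obtain ⟨s, hs, rfl⟩ := hx; exact hs.2
    | zero => simp
    | add x y _ _ hx hy => rw [inner_add_right, hx, hy, add_zero]
    | smul a x _ hx => rw [inner_smul_right, hx, mul_zero]
  rw [← heq] at this
  have h := orth_face hv hy this
  rw [hyK'.2, one_smul] at h
  exact h.symm

lemma local_basis {n : ℕ} (hn : 1 ≤ n) {S : Finset (E n)} {v : E n} (hv : v ∈ S)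
    (hspan : affineSpan ℝ (convexHull ℝ (S : Set (E n))) = ⊤)
    (hexp : IsExposed ℝ (convexHull ℝ (S : Set (E n))) {v})
    (hcard : {G : Set (E n) | IsIFace (convexHull ℝ (S : Set (E n))) G (n - 1) ∧ G ⊇ {v}}.ncard = n) :
    ∃ e : Module.Basis (Fin n) ℝ (E n), (∀ i, v + e i ∈ S) ∧
      ∀ s ∈ S, ∀ i, 0 ≤ e.repr (s - v) i := by
  set X := (dualBase S v).extremePoints ℝ with hX
  -- finiteness and cardinality of `X`
  have hGfin := Set.finite_of_ncard_pos (by rw [hcard]; omega)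
  have hmaps : Set.MapsTo (faceOf S v) X
      {G : Set (E n) | IsIFace (convexHull ℝ (S : Set (E n))) G (n - 1) ∧ G ⊇ {v}} := by
    intro y hy
    have := faceOf_facet hn hv hspan hy
    exact ⟨this.1, Set.singleton_subset_iff.2 this.2⟩
  have hXfin : X.Finite := Set.Finite.of_injOn hmaps (faceOf_inj hv) hGfin
  have hXcard : X.ncard ≤ n := by
    refine le_of_le_of_eq ?_ hcard
    exact Set.ncard_le_ncard_of_injOn _ hmaps (faceOf_inj hv) hGfin
  have hKM := closure_convexHull_extremePoints (dualBase_compact hv hspan) (dualBase_convex S v)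
  rw [← hX, (hXfin.isClosed_convexHull ℝ).closure_eq] at hKM
  -- conic generation
  have hgen : ∀ y : E n, (∀ s ∈ S, 0 ≤ inner ℝ y (s - v)) →
      ∃ c : E n → ℝ, (∀ x ∈ hXfin.toFinset, 0 ≤ c x) ∧ ∑ x ∈ hXfin.toFinset, c x • x = y := by
    intro y hy
    set σ := ∑ s ∈ S, inner ℝ y (s - v) with hσ
    have hσ0 : 0 ≤ σ := Finset.sum_nonneg hy
    rcases hσ0.eq_or_lt with h0 | h0
    · have : y = 0 := inner_eq_zero_of_span hv hspan
        ((Finset.sum_eq_zero_iff_of_nonneg hy).1 h0.symm)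
      exact ⟨0, by simp, by simp [this]⟩
    · have hmem : σ⁻¹ • y ∈ dualBase S v := by
        refine ⟨fun s hs => ?_, ?_⟩
        · rw [real_inner_smul_left]
          exact mul_nonneg (inv_nonneg.2 hσ0) (hy s hs)
        · simp only [real_inner_smul_left, ← Finset.mul_sum]
          rw [← hσ]; exact inv_mul_cancel₀ h0.ne'
      rw [← hKM, ← hXfin.coe_toFinset, Finset.mem_convexHull'] at hmem
      obtain ⟨w, hw0, -, hw⟩ := hmem
      refine ⟨fun x => σ * w x, fun x hx => mul_nonneg hσ0 (hw0 x hx), ?_⟩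
      simp only [mul_smul, ← Finset.smul_sum, hw]
      rw [smul_smul, mul_inv_cancel₀ h0.ne', one_smul]
  -- strictly positive functional
  obtain ⟨y0, hy0⟩ : ∃ y0 : E n, ∀ s ∈ S, s ≠ v → 0 < inner ℝ y0 (s - v) := by
    obtain ⟨l, hl⟩ := hexp ⟨v, rfl⟩
    refine ⟨-((InnerProductSpace.toDual ℝ (E n)).symm l), fun s hs hne => ?_⟩
    rw [inner_neg_left, InnerProductSpace.toDual_symm_apply, map_sub]
    have hvm : v ∈ ({v} : Set (E n)) := rfl
    rw [hl] at hvm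
    have hle := hvm.2 s (subset_convexHull ℝ _ hs)
    rcases hle.lt_or_eq with h | h
    · linarith
    · exfalso
      apply hne
      have : s ∈ ({v} : Set (E n)) := by
        rw [hl]
        exact ⟨subset_convexHull ℝ _ hs, fun y hy => by rw [h]; exact hvm.2 y hy⟩
      exact this
  have hy0' : ∀ s ∈ S, 0 ≤ inner ℝ y0 (s - v) := by
    intro s hs
    rcases eq_or_ne s v with rfl | h
    · simp
    · exact (hy0 s hs h).le
  have hspanmem : ∀ y : E n, (∀ s ∈ S, 0 ≤ inner ℝ y (s - v)) → y ∈ Submodule.span ℝ X := by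
    intro y hy
    obtain ⟨c, -, rfl⟩ := hgen y hy
    exact Submodule.sum_mem _ fun x hx => Submodule.smul_mem _ _
      (Submodule.subset_span (by simpa using hx))
  have hXspan : Submodule.span ℝ X = ⊤ := by
    rw [eq_top_iff]
    intro z _
    obtain ⟨ε, hε, h⟩ := perturb (z := z) hy0' (by
      intro s hs h0
      rcases eq_or_ne s v with rfl | hne
      · simp
      · exact absurd h0 (hy0 s hs hne).ne')
    have h1 := Submodule.sub_mem _ (hspanmem _ (h ε hε.le le_rfl)) (hspanmem _ hy0')
    have h2 := Submodule.smul_mem _ ε⁻¹ h1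
    rwa [add_sub_cancel_left, smul_smul, inv_mul_cancel₀ hε.ne', one_smul] at h2
  have hXcard' : hXfin.toFinset.card = n := by
    apply le_antisymm
    · rwa [← Set.ncard_eq_toFinset_card X hXfin]
    · have := finrank_span_finset_le_card (R := ℝ) hXfin.toFinset
      rw [hXfin.coe_toFinset] at this
      unfold Set.finrank at this
      rwa [hXspan, finrank_top, finrank_euclideanSpace_fin] at this
  let eq : Fin n ≃ hXfin.toFinset := (hXfin.toFinset.equivFinOfCardEq hXcard').symm
  let b : Fin n → E n := fun i => (eq i : E n)
  have hbrange : Set.range b = X := by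
    ext x
    constructor
    · rintro ⟨i, rfl⟩; exact hXfin.mem_toFinset.1 (eq i).2
    · intro hx; exact ⟨eq.symm ⟨x, by simpa using hx⟩, by simp [b]⟩
  have hbli : LinearIndependent ℝ b :=
    linearIndependent_of_top_le_span_of_card_eq_finrank (by rw [hbrange, hXspan]) (by simp)
  have hbpos : ∀ i, ∀ s ∈ S, 0 ≤ inner ℝ (b i) (s - v) := by
    intro i
    have : b i ∈ X := hbrange ▸ Set.mem_range_self i
    exact (extremePoints_subset this).1
  have hgen' : ∀ y : E n, (∀ s ∈ S, 0 ≤ inner ℝ y (s - v)) →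
      ∃ c : Fin n → ℝ, (∀ i, 0 ≤ c i) ∧ ∑ i, c i • b i = y := by
    intro y hy
    obtain ⟨c, hc, rfl⟩ := hgen y hy
    refine ⟨fun i => c (b i), fun i => hc _ (eq i).2, ?_⟩
    rw [← Finset.sum_coe_sort hXfin.toFinset]
    exact Equiv.sum_comp eq (fun x => c x • (x : E n))
  -- edges
  have hedge : ∀ j, ∃ s ∈ S, (∀ i, i ≠ j → inner ℝ (b i) (s - v) = 0) ∧
      0 < inner ℝ (b j) (s - v) := by
    intro j
    by_contra hcon
    push Not at hcon
    set y := ∑ i ∈ Finset.univ.erase j, b i with hy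
    have hyi : ∀ s, inner ℝ y (s - v) = ∑ i ∈ Finset.univ.erase j, inner ℝ (b i) (s - v) := by
      intro s; rw [hy, sum_inner]
    have hyC : ∀ s ∈ S, 0 ≤ inner ℝ y (s - v) := fun s hs => by
      rw [hyi]; exact Finset.sum_nonneg fun i _ => hbpos i s hs
    obtain ⟨ε, hε, h⟩ := perturb (z := -b j) hyC (by
      intro s hs h0
      rw [hyi, Finset.sum_eq_zero_iff_of_nonneg (fun i _ => hbpos i s hs)] at h0
      rw [inner_neg_left]
      have := hcon s hs (fun i hi => h0 i (by simp [hi]))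
      linarith)
    obtain ⟨c, hc, hceq⟩ := hgen' _ (h ε hε.le le_rfl)
    have h3 : ∑ i, (if i = j then -ε else 1) • b i = y + ε • (-b j) := by
      rw [← Finset.add_sum_erase _ _ (Finset.mem_univ j), if_pos rfl, hy, add_comm]
      congr 1
      · apply Finset.sum_congr rfl
        intro i hi
        rw [if_neg (Finset.ne_of_mem_erase hi), one_smul]
      · simp
    rw [← h3] at hceq
    have h4 := (Fintype.linearIndependent_iff.1 hbli) (fun i => c i - (if i = j then -ε else 1)) (by
      simp only [sub_smul, Finset.sum_sub_distrib, hceq, sub_self]) j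
    simp at h4
    linarith [hc j]
  choose t htS ht0 htpos using hedge
  have heli : LinearIndependent ℝ (fun j => t j - v) := by
    rw [Fintype.linearIndependent_iff]
    intro g hg i
    have h1 : inner ℝ (b i) (∑ j, g j • (t j - v)) = 0 := by rw [hg, inner_zero_right]
    rw [inner_sum, Finset.sum_eq_single i] at h1
    · rw [inner_smul_right] at h1
      exact (mul_eq_zero.1 h1).resolve_right (htpos i).ne'
    · intro j _ hj
      rw [inner_smul_right, ht0 j i hj.symm, mul_zero]
    · simp
  have : Nonempty (Fin n) := ⟨⟨0, hn⟩⟩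
  let e := basisOfLinearIndependentOfCardEqFinrank heli (by simp)
  have he : ∀ i, e i = t i - v := fun i => by simp [e]
  refine ⟨e, fun i => by rw [he]; simpa using htS i, fun s hs i => ?_⟩
  have h1 : inner ℝ (b i) (s - v) = e.repr (s - v) i * inner ℝ (b i) (t i - v) := by
    conv_lhs => rw [← e.sum_repr (s - v)]
    rw [inner_sum, Finset.sum_eq_single i]
    · rw [inner_smul_right, he]
    · intro j _ hj
      rw [inner_smul_right, he, ht0 j i hj.symm, mul_zero]
    · simp
  have h2 := hbpos i s hs
  rw [h1] at h2
  exact nonneg_of_mul_nonneg_left h2 (htpos i)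

/-- coordinate face at `v` -/
def cFace {n : ℕ} (S : Finset (E n)) (v : E n) (e : Module.Basis (Fin n) ℝ (E n))
    (A : Finset (Fin n)) : Set (E n) :=
  {x | x ∈ convexHull ℝ (S : Set (E n)) ∧ ∀ i, i ∉ A → e.repr (x - v) i = 0}

section
variable {n : ℕ} {S : Finset (E n)} {v : E n} {e : Module.Basis (Fin n) ℝ (E n)}

lemma self_mem_cFace (hv : v ∈ S) (A : Finset (Fin n)) : v ∈ cFace S v e A :=
  ⟨subset_convexHull ℝ _ hv, by simp⟩

lemma edge_mem_cFace (he : ∀ i, v + e i ∈ S) (A : Finset (Fin n)) (i : Fin n) :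
    v + e i ∈ cFace S v e A ↔ i ∈ A := by
  constructor
  · intro h
    by_contra hi
    have := h.2 i hi
    simp at this
  · intro hi
    refine ⟨subset_convexHull ℝ _ (he i), fun j hj => ?_⟩
    have : i ≠ j := by rintro rfl; exact hj hi
    simp [this]

lemma cFace_inj (he : ∀ i, v + e i ∈ S) : Function.Injective (cFace S v e) := by
  intro A B h
  ext i
  rw [← edge_mem_cFace he A i, h, edge_mem_cFace he B i]

lemma repr_nonneg (hc : ∀ s ∈ S, ∀ i, 0 ≤ e.repr (s - v) i) :
    ∀ x ∈ convexHull ℝ (S : Set (E n)), ∀ i, 0 ≤ e.repr (x - v) i := by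
  intro x hx i
  have h := hull_nonneg (e.coord i) (e.coord i v) (fun s hs => by
    have := hc s hs i
    rw [← e.coord_apply, map_sub] at this; linarith) x hx
  rw [← e.coord_apply, map_sub]; linarith

lemma cFace_dim (hv : v ∈ S) (he : ∀ i, v + e i ∈ S) (A : Finset (Fin n)) :
    faceDim (cFace S v e A) = A.card := by
  unfold faceDim
  rw [direction_affineSpan, vectorSpan_eq_span_vsub_set_right ℝ (self_mem_cFace hv A)]
  have : Submodule.span ℝ ((fun x => x -ᵥ v) '' cFace S v e A)
      = Submodule.span ℝ (Set.range fun i : A => e i) := by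
    apply le_antisymm
    · rw [Submodule.span_le]
      rintro _ ⟨x, hx, rfl⟩
      change x - v ∈ Submodule.span ℝ (Set.range fun i : A => e i)
      rw [← e.sum_repr (x - v)]
      refine Submodule.sum_mem _ fun i _ => ?_
      by_cases hi : i ∈ A
      · exact Submodule.smul_mem _ _ (Submodule.subset_span ⟨⟨i, hi⟩, rfl⟩)
      · rw [hx.2 i hi, zero_smul]; exact Submodule.zero_mem _
    · rw [Submodule.span_le]
      rintro _ ⟨i, rfl⟩
      exact Submodule.subset_span ⟨v + e i, (edge_mem_cFace he A i).2 i.2, by simp⟩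
  have hli : LinearIndependent ℝ (fun i : A => e i) :=
    e.linearIndependent.comp _ Subtype.val_injective
  rw [this, finrank_span_eq_card hli]
  simp

lemma cFace_isFace (hv : v ∈ S) (he : ∀ i, v + e i ∈ S)
    (hc : ∀ s ∈ S, ∀ i, 0 ≤ e.repr (s - v) i)
    (hspan : affineSpan ℝ (convexHull ℝ (S : Set (E n))) = ⊤)
    (A : Finset (Fin n)) (hA : A.card < n) :
    IsIFace (convexHull ℝ (S : Set (E n))) (cFace S v e A) A.card := by
  refine ⟨⟨⟨v, self_mem_cFace hv A⟩, ?_, ?_⟩, cFace_dim hv he A⟩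
  · intro h
    have h2 := cFace_dim (S := S) hv he A
    rw [h] at h2
    unfold faceDim at h2
    rw [hspan, AffineSubspace.direction_top, finrank_top, finrank_euclideanSpace_fin] at h2
    omega
  · have h := exposed_of_nonneg hv (∑ i ∈ Aᶜ, e.coord i) (fun s hs => by
      rw [LinearMap.sum_apply]
      exact Finset.sum_nonneg fun i _ => hc s hs i)
    convert h using 1
    ext x
    simp only [cFace, Set.mem_ofPred_eq]
    refine and_congr_right fun hx => ?_
    rw [LinearMap.sum_apply]
    simp only [Module.Basis.coord_apply]
    rw [Finset.sum_eq_zero_iff_of_nonneg (fun i _ => repr_nonneg hc x hx i)]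
    simp

lemma face_eq_cFace (hv : v ∈ S) (he : ∀ i, v + e i ∈ S)
    (hc : ∀ s ∈ S, ∀ i, 0 ≤ e.repr (s - v) i) {F : Set (E n)} {k : ℕ}
    (hF : IsIFace (convexHull ℝ (S : Set (E n))) F k) (hvF : v ∈ F) :
    ∃ A : Finset (Fin n), A.card = k ∧ F = cFace S v e A := by
  classical
  obtain ⟨l, hl⟩ := hF.1.2.2 ⟨v, hvF⟩
  have hvm := hvF
  rw [hl] at hvm
  have hle : ∀ i, l (e i) ≤ 0 := fun i => by
    have := hvm.2 _ (subset_convexHull ℝ _ (he i))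
    rw [map_add] at this; linarith
  have hFA : F = cFace S v e (Finset.univ.filter fun i => l (e i) = 0) := by
    ext x
    rw [hl]
    simp only [cFace, Set.mem_ofPred_eq]
    refine and_congr_right fun hx => ?_
    have hlx : l x = l v + ∑ i, e.repr (x - v) i * l (e i) := by
      have h1 : l (x - v) = ∑ i, e.repr (x - v) i * l (e i) := by
        conv_lhs => rw [← e.sum_repr (x - v)]
        simp
      rw [map_sub] at h1; linarith
    have hnp : ∀ i ∈ Finset.univ, e.repr (x - v) i * l (e i) ≤ 0 := fun i _ =>
      mul_nonpos_of_nonneg_of_nonpos (repr_nonneg hc x hx i) (hle i)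
    constructor
    · intro h i hi
      have h2 := h v (subset_convexHull ℝ _ hv)
      have h3 : ∑ i, e.repr (x - v) i * l (e i) = 0 :=
        le_antisymm (Finset.sum_nonpos hnp) (by linarith)
      rw [Finset.sum_eq_zero_iff_of_nonpos hnp] at h3
      exact (mul_eq_zero.1 (h3 i (Finset.mem_univ i))).resolve_right (by simpa using hi)
    · intro h y hy
      have h3 : ∑ i, e.repr (x - v) i * l (e i) = 0 := by
        apply Finset.sum_eq_zero
        intro i _
        by_cases hi : l (e i) = 0
        · rw [hi, mul_zero]
        · rw [h i (by simpa using hi), zero_mul]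
      rw [hlx, h3, add_zero]
      exact hvm.2 y hy
  refine ⟨_, ?_, hFA⟩
  rw [← cFace_dim (S := S) hv he, ← hFA]
  exact hF.2

lemma cFace_max (φ : E n →ₗ[ℝ] ℝ) (hc : ∀ s ∈ S, ∀ i, 0 ≤ e.repr (s - v) i)
    {A : Finset (Fin n)} (hA : ∀ i ∈ A, φ (e i) ≤ 0) {x : E n} (hx : x ∈ cFace S v e A) :
    φ x ≤ φ v := by
  have h1 : φ (x - v) = ∑ i, e.repr (x - v) i * φ (e i) := by
    conv_lhs => rw [← e.sum_repr (x - v)]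
    simp
  have h2 : ∑ i, e.repr (x - v) i * φ (e i) ≤ 0 := by
    apply Finset.sum_nonpos
    intro i _
    by_cases hi : i ∈ A
    · exact mul_nonpos_of_nonneg_of_nonpos (repr_nonneg hc x hx.1 i) (hA i hi)
    · rw [hx.2 i hi, zero_mul]
  rw [map_sub] at h1; linarith

end

lemma exists_vertex_mem {n : ℕ} {S : Finset (E n)} (hS : S.Nonempty) {F : Set (E n)}
    (hF : F.Nonempty) (hexp : IsExposed ℝ (convexHull ℝ (S : Set (E n))) F) : ∃ v ∈ S, v ∈ F := by
  obtain ⟨l, hl⟩ := hexp hF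
  obtain ⟨v, hv, hmax⟩ := S.exists_max_image l hS
  refine ⟨v, hv, ?_⟩
  rw [hl]
  refine ⟨subset_convexHull ℝ _ hv, fun y hy => ?_⟩
  have := hull_nonneg (-(l : E n →ₗ[ℝ] ℝ)) (-(l v)) (fun s hs => by simpa using hmax s hs) y hy
  simpa using this

lemma singleton_isFace {n : ℕ} (hn : 1 ≤ n) {P : Set (E n)} (hspan : affineSpan ℝ P = ⊤)
    {s : E n} (hexp : IsExposed ℝ P {s}) : IsIFace P {s} 0 := by
  have hd : faceDim ({s} : Set (E n)) = 0 := by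
    unfold faceDim; rw [direction_affineSpan, vectorSpan_singleton, finrank_bot]
  refine ⟨⟨⟨s, rfl⟩, ?_, hexp⟩, hd⟩
  intro h
  rw [h] at hd
  unfold faceDim at hd
  rw [hspan, AffineSubspace.direction_top, finrank_top, finrank_euclideanSpace_fin] at hd
  omega

lemma zeroFace_eq {n : ℕ} {S : Finset (E n)} (hS : S.Nonempty) {V : Set (E n)}
    (hV : IsIFace (convexHull ℝ (S : Set (E n))) V 0) : ∃ s ∈ S, V = {s} := by
  obtain ⟨s, hs, hsV⟩ := exists_vertex_mem hS hV.1.1 hV.1.2.2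
  refine ⟨s, hs, ?_⟩
  have hd := hV.2
  unfold faceDim at hd
  rw [Submodule.finrank_eq_zero] at hd
  ext x
  rw [Set.mem_singleton_iff]
  constructor
  · intro hx
    have := AffineSubspace.vsub_mem_direction (subset_affineSpan ℝ _ hx) (subset_affineSpan ℝ _ hsV)
    rw [hd] at this
    exact sub_eq_zero.1 (by simpa using this)
  · rintro rfl; exact hsV

open Classical in
lemma nFacesIn_zero {n : ℕ} (hn : 1 ≤ n) {S : Finset (E n)} (hS : S.Nonempty)
    (hspan : affineSpan ℝ (convexHull ℝ (S : Set (E n))) = ⊤)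
    (hexp : ∀ s ∈ S, IsExposed ℝ (convexHull ℝ (S : Set (E n))) {s}) (F : Set (E n)) :
    nFacesIn (convexHull ℝ (S : Set (E n))) F 0 = (S.filter (· ∈ F)).card := by
  unfold nFacesIn
  have : {G : Set (E n) | IsIFace (convexHull ℝ (S : Set (E n))) G 0 ∧ G ⊆ F}
      = (fun s => ({s} : Set (E n))) '' ((S.filter (· ∈ F) : Finset (E n)) : Set (E n)) := by
    ext G
    constructor
    · rintro ⟨hG, hGF⟩
      obtain ⟨s, hs, rfl⟩ := zeroFace_eq hS hG
      exact ⟨s, by simpa [hs] using hGF, rfl⟩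
    · rintro ⟨s, hs, rfl⟩
      simp only [Finset.coe_filter, Set.mem_ofPred_eq] at hs
      exact ⟨singleton_isFace hn hspan (hexp s hs.1), by simpa using hs.2⟩
  rw [this, Set.ncard_image_of_injective _ Set.singleton_injective, Set.ncard_coe_finset]

open Classical in
lemma count_down {n : ℕ} (hn : 9 ≤ n) {S : Finset (E n)}
    (hspan : affineSpan ℝ (convexHull ℝ (S : Set (E n))) = ⊤)
    (e : E n → Module.Basis (Fin n) ℝ (E n)) (he : ∀ v ∈ S, ∀ i, v + e v i ∈ S)
    (hc : ∀ v ∈ S, ∀ s ∈ S, ∀ i, 0 ≤ (e v).repr (s - v) i)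
    (φ : E n →ₗ[ℝ] ℝ) (hφ : ∀ s ∈ S, ∀ t ∈ S, φ s = φ t → s = t)
    (Fs : Finset (Set (E n))) (hFs : ∀ F, F ∈ Fs ↔ IsIFace (convexHull ℝ (S : Set (E n))) F 2) :
    ∑ v ∈ S, (Finset.univ.filter fun i => φ (e v i) < 0).card.choose 2 ≤ Fs.card := by
  let D : E n → Finset (Fin n) := fun v => Finset.univ.filter fun i => φ (e v i) < 0
  let g : E n → Finset (Set (E n)) := fun v =>
    ((D v).powersetCard 2).image (cFace S v (e v))
  have hg : ∀ v ∈ S, (g v).card = (D v).card.choose 2 := by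
    intro v hv
    rw [Finset.card_image_of_injective _ (cFace_inj (he v hv)), Finset.card_powersetCard]
  have hmax : ∀ v ∈ S, ∀ F ∈ g v, v ∈ F ∧ ∀ x ∈ F, φ x ≤ φ v := by
    intro v hv F hF
    obtain ⟨A, hA, rfl⟩ := Finset.mem_image.1 hF
    rw [Finset.mem_powersetCard] at hA
    refine ⟨self_mem_cFace hv A, fun x hx => cFace_max φ (hc v hv) (fun i hi => ?_) hx⟩
    have := hA.1 hi
    simp only [D, Finset.mem_filter] at this
    exact this.2.le
  have hdisj : (S : Set (E n)).PairwiseDisjoint g := by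
    intro v hv w hw hne
    rw [Function.onFun, Finset.disjoint_left]
    intro F hF hF'
    have h1 := hmax v hv F hF
    have h2 := hmax w hw F hF'
    exact hne (hφ v hv w hw (le_antisymm (h2.2 v h1.1) (h1.2 w h2.1)))
  have hsub : S.biUnion g ⊆ Fs := by
    intro F hF
    obtain ⟨v, hv, hF⟩ := Finset.mem_biUnion.1 hF
    obtain ⟨A, hA, rfl⟩ := Finset.mem_image.1 hF
    rw [Finset.mem_powersetCard] at hA
    rw [hFs]
    have := cFace_isFace hv (he v hv) (hc v hv) hspan A (by omega)
    rwa [hA.2] at this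
  calc _ = ∑ v ∈ S, (g v).card := Finset.sum_congr rfl fun v hv => (hg v hv).symm
    _ = (S.biUnion g).card := (Finset.card_biUnion hdisj).symm
    _ ≤ _ := Finset.card_le_card hsub

lemma choose_two_eq (a : ℕ) : 2 * (a.choose 2 : ℤ) = a * (a - 1) := by
  induction a with
  | zero => simp
  | succ a ih => rw [Nat.choose_succ_succ' a 1, Nat.choose_one_right]; push_cast; linarith

lemma numeric {a b n : ℕ} (hn : 9 ≤ n) (h : a + b = n) :
    2 * (4 * n.choose 2 + (n + 6)) + 1 ≤ 20 * (a.choose 2 + b.choose 2) := by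
  have h1 := choose_two_eq a
  have h2 := choose_two_eq b
  have h3 := choose_two_eq n
  zify
  have hz : (a : ℤ) + b = n := by exact_mod_cast h
  have hn' : (9 : ℤ) ≤ n := by exact_mod_cast hn
  rcases hn.eq_or_lt with rfl | hlt
  · have : a ≤ 9 := by omega
    have hb : b = 9 - a := by omega
    subst hb
    clear h1 h2 h3 hz
    interval_cases a <;> simp [Nat.choose]
  · have hn'' : (10 : ℤ) ≤ n := by exact_mod_cast hlt
    subst h
    push_cast at *
    nlinarith [sq_nonneg ((a : ℤ) - b), mul_nonneg (sub_nonneg.2 hn'') (sub_nonneg.2 hn'')]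

open Classical in
lemma double_count {α : Type*} (S : Finset α) (Fs : Finset (Set α)) :
    ∑ F ∈ Fs, (S.filter (· ∈ F)).card = ∑ v ∈ S, (Fs.filter (v ∈ ·)).card := by
  simp_rw [Finset.card_filter]
  exact Finset.sum_comm

/-- **Combinatorial core of Theorem 1.** For `n ≥ 9` there is no `n`-dimensional simple
polytope in `ℝⁿ` without triangular 2-faces and with every vertex contained in at most
`n+6` quadrilateral 2-faces. -/
theorem no_simple_polytope_of_dim_ge_nine (n : ℕ) (hn : 9 ≤ n) :
    ¬ ∃ P : Set (E n), IsSimplePolytope n P ∧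
      (∀ F : Set (E n), ¬ (IsIFace P F 2 ∧ nFacesIn P F 0 = 3)) ∧
      (∀ V : Set (E n), IsIFace P V 0 →
        {F : Set (E n) | IsIFace P F 2 ∧ nFacesIn P F 0 = 4 ∧ V ⊆ F}.ncard ≤ n + 6) := by
  classical
  rintro ⟨P, ⟨hpoly, hspan, hsimple⟩, htri, hquad⟩
  obtain ⟨S, hS, rfl, hexp⟩ := exists_vertex_set hpoly
  have hn1 : 1 ≤ n := by omega
  have hloc : ∀ v : E n, ∃ e : Module.Basis (Fin n) ℝ (E n), v ∈ S → (∀ i, v + e i ∈ S) ∧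
      ∀ s ∈ S, ∀ i, 0 ≤ e.repr (s - v) i := by
    intro v
    by_cases hv : v ∈ S
    · obtain ⟨e, h⟩ := local_basis hn1 hv hspan (hexp v hv)
        (by simpa using hsimple 0 (by omega) {v} (singleton_isFace hn1 hspan (hexp v hv)))
      exact ⟨e, fun _ => h⟩
    · exact ⟨(EuclideanSpace.basisFun (Fin n) ℝ).toBasis, fun h => absurd h hv⟩
  choose e hloc using hloc
  have he : ∀ v ∈ S, ∀ i, v + e v i ∈ S := fun v hv => (hloc v hv).1
  have hc : ∀ v ∈ S, ∀ s ∈ S, ∀ i, 0 ≤ (e v).repr (s - v) i := fun v hv => (hloc v hv).2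
  -- 2-faces
  have hsubF : ∀ F, IsIFace (convexHull ℝ (S : Set (E n))) F 2 →
      F ∈ S.biUnion fun v => (Finset.univ.powersetCard 2).image (cFace S v (e v)) := by
    intro F hF
    obtain ⟨v, hv, hvF⟩ := exists_vertex_mem hS hF.1.1 hF.1.2.2
    obtain ⟨A, hA, rfl⟩ := face_eq_cFace hv (he v hv) (hc v hv) hF hvF
    exact Finset.mem_biUnion.2 ⟨v, hv, Finset.mem_image.2 ⟨A, by simp [hA], rfl⟩⟩
  obtain ⟨Fs, hFs⟩ : ∃ Fs : Finset (Set (E n)),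
      ∀ F, F ∈ Fs ↔ IsIFace (convexHull ℝ (S : Set (E n))) F 2 := by
    refine ⟨(S.biUnion fun v => (Finset.univ.powersetCard 2).image (cFace S v (e v))).filter
      (fun F => IsIFace (convexHull ℝ (S : Set (E n))) F 2), fun F => ?_⟩
    rw [Finset.mem_filter]
    exact ⟨fun h => h.2, fun h => ⟨hsubF F h, h⟩⟩
  have hdeg := nFacesIn_zero hn1 hS hspan hexp
  -- 2-faces at a vertex
  have hat : ∀ v ∈ S, (Fs.filter (v ∈ ·)).card ≤ n.choose 2 := by
    intro v hv
    have hsub : Fs.filter (v ∈ ·) ⊆ (Finset.univ.powersetCard 2).image (cFace S v (e v)) := by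
      intro F hF
      rw [Finset.mem_filter, hFs] at hF
      obtain ⟨A, hA, rfl⟩ := face_eq_cFace hv (he v hv) (hc v hv) hF.1 hF.2
      exact Finset.mem_image.2 ⟨A, by simp [hA], rfl⟩
    refine (Finset.card_le_card hsub).trans (Finset.card_image_le.trans ?_)
    simp
  -- every 2-face has at least four vertices
  have hge : ∀ F ∈ Fs, 4 ≤ (S.filter (· ∈ F)).card := by
    intro F hF
    rw [hFs] at hF
    have h3 : (S.filter (· ∈ F)).card ≠ 3 := fun h => htri F ⟨hF, by rw [hdeg, h]⟩
    have : 3 ≤ (S.filter (· ∈ F)).card := by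
      obtain ⟨v, hv, hvF⟩ := exists_vertex_mem hS hF.1.1 hF.1.2.2
      obtain ⟨A, hA, rfl⟩ := face_eq_cFace hv (he v hv) (hc v hv) hF hvF
      have hsub : insert v (A.image fun i => v + e v i) ⊆ S.filter (· ∈ cFace S v (e v) A) := by
        intro x hx
        rw [Finset.mem_filter]
        rcases Finset.mem_insert.1 hx with rfl | hx
        · exact ⟨hv, hvF⟩
        · obtain ⟨i, hi, rfl⟩ := Finset.mem_image.1 hx
          exact ⟨he v hv i, (edge_mem_cFace (he v hv) A i).2 hi⟩
      refine le_trans (le_of_eq ?_) (Finset.card_le_card hsub)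
      rw [Finset.card_insert_of_notMem, Finset.card_image_of_injective, hA]
      · intro i j hij
        exact (e v).injective (by simpa using hij)
      · intro h
        obtain ⟨i, -, hi⟩ := Finset.mem_image.1 h
        exact (e v).ne_zero i (by simpa using hi)
    omega
  -- counting
  let Q := Fs.filter fun F => (S.filter (· ∈ F)).card = 4
  have hQ : 4 * Q.card ≤ (n + 6) * S.card := by
    have h1 : ∑ F ∈ Q, (S.filter (· ∈ F)).card = 4 * Q.card := by
      rw [Finset.sum_const_nat (m := 4) (fun F hF => (Finset.mem_filter.1 hF).2), mul_comm]
    rw [← h1, double_count, mul_comm]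
    apply Finset.sum_le_card_nsmul
    intro v hv
    have h2 := hquad {v} (singleton_isFace hn1 hspan (hexp v hv))
    have h3 : {F : Set (E n) | IsIFace (convexHull ℝ (S : Set (E n))) F 2 ∧
        nFacesIn (convexHull ℝ (S : Set (E n))) F 0 = 4 ∧ {v} ⊆ F}
        = ((Q.filter (v ∈ ·) : Finset (Set (E n))) : Set (Set (E n))) := by
      ext F
      simp only [Q, Finset.coe_filter, Finset.mem_filter, Set.mem_ofPred_eq, hFs, hdeg,
        Set.singleton_subset_iff, and_assoc]
    rwa [h3, Set.ncard_coe_finset] at h2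
  have hF5 : 5 * Fs.card ≤ n.choose 2 * S.card + Q.card := by
    have h1 : ∑ F ∈ Fs, (S.filter (· ∈ F)).card ≤ n.choose 2 * S.card := by
      rw [double_count, mul_comm]
      exact Finset.sum_le_card_nsmul _ _ _ hat
    have h2 : 5 * Fs.card ≤ ∑ F ∈ Fs, ((S.filter (· ∈ F)).card +
        if (S.filter (· ∈ F)).card = 4 then 1 else 0) := by
      rw [mul_comm, ← smul_eq_mul]
      apply Finset.card_nsmul_le_sum
      intro F hF
      have := hge F hF
      split_ifs <;> omega
    rw [Finset.sum_add_distrib, ← Finset.card_filter] at h2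
    exact h2.trans (Nat.add_le_add_right h1 _)
  -- generic functional
  obtain ⟨φ, hφ⟩ := Module.exists_dual_forall_apply_ne_zero (K := ℝ)
    (fun p : {p : S × S // p.1 ≠ p.2} => ((p.1.1 : E n) - (p.1.2 : E n)))
    (fun p h => p.2 (Subtype.ext (sub_eq_zero.1 h)))
  have hφ' : ∀ s ∈ S, ∀ t ∈ S, φ s = φ t → s = t := by
    intro s hs t ht h
    by_contra hne
    apply hφ ⟨(⟨s, hs⟩, ⟨t, ht⟩), fun h => hne (congrArg Subtype.val h)⟩
    rw [map_sub]
    exact sub_eq_zero.2 h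
  have hd := count_down hn hspan e he hc φ hφ' Fs hFs
  have hu := count_down hn hspan e he hc (-φ) (fun s hs t ht h => hφ' s hs t ht (by simpa using h))
    Fs hFs
  have hpt : ∀ v ∈ S, 2 * (4 * n.choose 2 + (n + 6)) + 1 ≤
      20 * ((Finset.univ.filter fun i => φ (e v i) < 0).card.choose 2 +
        (Finset.univ.filter fun i => (-φ) (e v i) < 0).card.choose 2) := by
    intro v hv
    apply numeric hn
    have h1 : (Finset.univ.filter fun i => (-φ) (e v i) < 0)
        = Finset.univ.filter fun i => ¬ φ (e v i) < 0 := by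
      apply Finset.filter_congr
      intro i _
      have hne : φ (e v i) ≠ 0 := by
        intro h0
        have := hφ' (v + e v i) (he v hv i) v hv (by rw [map_add, h0, add_zero])
        exact (e v).ne_zero i (by simpa using this)
      rw [LinearMap.neg_apply, neg_lt_zero, not_lt]
      exact ⟨le_of_lt, fun h => lt_of_le_of_ne h hne.symm⟩
    rw [h1, Finset.card_filter_add_card_filter_not]
    simp
  have hsum := Finset.card_nsmul_le_sum S _ _ hpt
  rw [← Finset.mul_sum, Finset.sum_add_distrib, smul_eq_mul] at hsum
  have hpos : 0 < S.card := hS.card_pos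
  nlinarith
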